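/- arXiv:0806.1878 — 2 statements merged into one kernel-verified Lean document; each statement's English description precedes it below -/
import Mathlib

section
/- For every τ in the complex upper half-plane with q = e^{2πiτ}, and every nonzero complex number w with w ≠ q^n for all integers n, one has Σ_{n∈ℤ} (−1)^n q^{n(n+1)/2}/(1 − w q^n) = (q;q)_∞^2 / ((w;q)_∞ (q/w;q)_∞). -/
open Complex

noncomputable section

/-- Finite q-Pochhammer symbol `(a;q)_n`. -/
def qPoch (a q : ℂ) (n : ℕ) : ℂ := ∏ j ∈ Finset.range n, (1 - a * q ^ j)

/-- Infinite q-Pochhammer symbol `(a;q)_∞`. -/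
def qPochInf (a q : ℂ) : ℂ := ∏' j : ℕ, (1 - a * q ^ j)

/-- Jacobi theta function `θ(z;τ)`. -/
def theta (z τ : ℂ) : ℂ :=
  ∑' n : ℤ, (-1 : ℂ) ^ n * Complex.exp (Real.pi * Complex.I * (2 * n + 1) * z) *
    Complex.exp (2 * Real.pi * Complex.I * τ * ((n : ℂ) * (n + 1) / 2 + 1 / 8))

/-- Zwegers' mock Jacobi form `μ(u,v;τ)`. -/
def mu (u v τ : ℂ) : ℂ :=
  Complex.exp (Real.pi * Complex.I * u) / theta v τ *
    ∑' n : ℤ, (-Complex.exp (2 * Real.pi * Complex.I * v)) ^ n *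
      Complex.exp (Real.pi * Complex.I * τ * n * (n + 1)) /
      (1 - Complex.exp (2 * Real.pi * Complex.I * u) *
        Complex.exp (2 * Real.pi * Complex.I * τ) ^ n)

/-- Dedekind eta function `η(τ)`. -/
def eta (τ : ℂ) : ℂ :=
  Complex.exp (Real.pi * Complex.I * τ / 12) *
    ∏' n : ℕ, (1 - Complex.exp (2 * Real.pi * Complex.I * τ * (n + 1)))

/-- Universal mock theta function `g₂(w;q)`. -/
def g2 (w q : ℂ) : ℂ :=
  ∑' n : ℕ, qPoch (-q) q n * q ^ (n * (n + 1) / 2) /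
    (qPoch w q (n + 1) * qPoch (q / w) q (n + 1))

/-- Universal mock theta function `g₃(w;q)`. -/
def g3 (w q : ℂ) : ℂ :=
  ∑' n : ℕ, q ^ (n * (n + 1)) / (qPoch w q (n + 1) * qPoch (q / w) q (n + 1))

/-- Rank generating function `𝓡(w;q)`. -/
def rankGF (w q : ℂ) : ℂ :=
  ∑' n : ℕ, q ^ (n ^ 2) / ∏ k ∈ Finset.range n, ((1 - w * q ^ (k + 1)) * (1 - q ^ (k + 1) / w))

/-- Crank generating function `𝓒(w;q)`. -/
def crankGF (w q : ℂ) : ℂ := qPochInf q q / (qPochInf (w * q) q * qPochInf (q / w) q)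

/-- The series `K'(w;τ)` with `q = e^{2πiτ}`. -/
def Kp (w q : ℂ) : ℂ :=
  ∑' n : ℕ, (-1 : ℂ) ^ n * q ^ (n ^ 2) * qPoch q (q ^ 2) n /
    (qPoch (w * q ^ 2) (q ^ 2) n * qPoch (q ^ 2 / w) (q ^ 2) n)

/-- The series `K''(w;τ)` with `q = e^{2πiτ}` (the sum starts at `n = 1`). -/
def Kpp (w q : ℂ) : ℂ :=
  ∑' n : ℕ, (-1 : ℂ) ^ (n + 1) * q ^ ((n + 1) ^ 2) * qPoch q (q ^ 2) n /
    (qPoch (w * q) (q ^ 2) (n + 1) * qPoch (q / w) (q ^ 2) (n + 1))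

/-- The series `ρ(a,b,c)` from the three variable reciprocity theorem. -/
def rho (a b c q : ℂ) : ℂ :=
  (1 + 1 / b) * ∑' n : ℕ, qPoch c q n * (-1 : ℂ) ^ n * q ^ (n * (n + 1) / 2) * (a / b) ^ n /
    (qPoch (-a * q) q n * qPoch (-c / b) q (n + 1))

lemma qPoch_succ (a q : ℂ) (n : ℕ) : qPoch a q (n + 1) = qPoch a q n * (1 - a * q ^ n) :=
  Finset.prod_range_succ _ _

lemma qPoch_succ' (a q : ℂ) (n : ℕ) : qPoch a q (n + 1) = (1 - a) * qPoch (a * q) q n := by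
  simp only [qPoch, Finset.prod_range_succ', pow_zero, mul_one]
  rw [mul_comm]
  congr 1
  exact Finset.prod_congr rfl fun j _ ↦ by ring

lemma qPoch_add (a q : ℂ) (m n : ℕ) :
    qPoch a q (m + n) = qPoch a q m * qPoch (a * q ^ m) q n := by
  simp only [qPoch, Finset.prod_range_add]
  congr 1
  exact Finset.prod_congr rfl fun j _ ↦ by ring

lemma qPoch_ne_zero {a q : ℂ} {n : ℕ} (h : ∀ j < n, 1 - a * q ^ j ≠ 0) : qPoch a q n ≠ 0 :=
  Finset.prod_ne_zero_iff.mpr fun j hj ↦ h j (Finset.mem_range.mp hj)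

/-- The `q`-Pascal rule, in its two forms, for sums against `1 / ((q;q)_i (q;q)_{M-i})`. -/
lemma q_pascal_sum {q : ℂ} (hq : ∀ n, qPoch q q n ≠ 0) (g : ℕ → ℂ) (M : ℕ) :
    (1 - q ^ (M + 1)) * ∑ i ∈ Finset.range (M + 2), g i / (qPoch q q i * qPoch q q (M + 1 - i)) =
      ∑ i ∈ Finset.range (M + 1), g i / (qPoch q q i * qPoch q q (M - i)) +
      ∑ i ∈ Finset.range (M + 1), q ^ (M - i) * g (i + 1) / (qPoch q q i * qPoch q q (M - i)) := by
  have h1 : ∑ i ∈ Finset.range (M + 1), g i / (qPoch q q i * qPoch q q (M - i)) =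
      ∑ i ∈ Finset.range (M + 2),
        (1 - q ^ (M + 1 - i)) * g i / (qPoch q q i * qPoch q q (M + 1 - i)) := by
    rw [Finset.sum_range_succ _ (M + 1)]
    simp only [tsub_self, pow_zero, sub_self, zero_mul, zero_div, add_zero]
    refine Finset.sum_congr rfl fun i hi ↦ ?_
    have hi' : i ≤ M := by simpa [Nat.lt_succ_iff] using hi
    have a1 := hq i
    have a2 := hq (M - i)
    have a3 := hq (M - i + 1)
    rw [Nat.sub_add_comm hi']
    rw [qPoch_succ] at a3 ⊢
    have a4 := right_ne_zero_of_mul a3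
    have : (1 : ℂ) - q ^ (M - i + 1) = 1 - q * q ^ (M - i) := by ring
    rw [this]
    field_simp
  have h2 : ∑ i ∈ Finset.range (M + 1),
        q ^ (M - i) * g (i + 1) / (qPoch q q i * qPoch q q (M - i)) =
      ∑ i ∈ Finset.range (M + 2),
        q ^ (M + 1 - i) * (1 - q ^ i) * g i / (qPoch q q i * qPoch q q (M + 1 - i)) := by
    rw [Finset.sum_range_succ' _ (M + 1)]
    simp only [pow_zero, sub_self, mul_zero, zero_mul, zero_div, add_zero, Nat.add_sub_add_right]
    refine Finset.sum_congr rfl fun i hi ↦ ?_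
    have a1 := hq i
    have a2 := hq (M - i)
    have a3 := hq (i + 1)
    rw [qPoch_succ] at a3 ⊢
    have a4 := right_ne_zero_of_mul a3
    have : (1 : ℂ) - q ^ (i + 1) = 1 - q * q ^ i := by ring
    rw [this]
    field_simp
  rw [h1, h2, ← Finset.sum_add_distrib, Finset.mul_sum]
  refine Finset.sum_congr rfl fun i hi ↦ ?_
  have hi' : i ≤ M + 1 := by
    have := Finset.mem_range.mp hi
    lia
  have : q ^ (M + 1) = q ^ (M + 1 - i) * q ^ i := by rw [← pow_add, Nat.sub_add_cancel hi']
  rw [this]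
  ring

lemma q_pascal_sum' {q : ℂ} (hq : ∀ n, qPoch q q n ≠ 0) (g : ℕ → ℂ) (M : ℕ) :
    (1 - q ^ (M + 1)) * ∑ i ∈ Finset.range (M + 2), g i / (qPoch q q i * qPoch q q (M + 1 - i)) =
      ∑ i ∈ Finset.range (M + 1), q ^ i * g i / (qPoch q q i * qPoch q q (M - i)) +
      ∑ i ∈ Finset.range (M + 1), g (i + 1) / (qPoch q q i * qPoch q q (M - i)) := by
  have h := q_pascal_sum hq (fun i ↦ g (M + 1 - i)) M
  rw [add_comm (∑ i ∈ _, _)] at h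
  convert h using 2
  · rw [← Finset.sum_range_reflect]
    refine Finset.sum_congr rfl fun i hi ↦ ?_
    have hi' : i ≤ M + 1 := by
      have := Finset.mem_range.mp hi
      lia
    rw [show M + 2 - 1 - i = M + 1 - i by lia, Nat.sub_sub_self hi', mul_comm (qPoch _ _ _)]
  · rw [← Finset.sum_range_reflect]
    refine Finset.sum_congr rfl fun i hi ↦ ?_
    have hi' : i ≤ M := by simpa [Nat.lt_succ_iff] using hi
    rw [show M + 1 - 1 - i = M - i by lia, Nat.sub_sub_self hi',
      show M + 1 - (i + 1) = M - i by lia, mul_comm (qPoch _ _ _)]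
  · rw [← Finset.sum_range_reflect]
    refine Finset.sum_congr rfl fun i hi ↦ ?_
    have hi' : i ≤ M := by simpa [Nat.lt_succ_iff] using hi
    rw [show M + 1 - 1 - i = M - i by lia, Nat.sub_sub_self hi',
      show M - i + 1 = M + 1 - i by lia, mul_comm (qPoch _ _ _)]

/-- Partial fraction expansion of `v ^ N / (v;q)_{M+1}` for `N ≤ M`. -/
lemma partial_fraction_qPoch {q : ℂ} (hq0 : q ≠ 0) (hq : ∀ n, qPoch q q n ≠ 0) (M : ℕ) :
    ∀ N ≤ M, ∀ v : ℂ, (∀ i ≤ M, 1 - v * q ^ i ≠ 0) →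
      ∑ i ∈ Finset.range (M + 1), (-1) ^ i * q ^ ((i + 1).choose 2) / (q ^ N) ^ i /
        (1 - v * q ^ i) / (qPoch q q i * qPoch q q (M - i)) = v ^ N / qPoch v q (M + 1) := by
  induction M with
  | zero =>
    intro N hN v hv
    obtain rfl : N = 0 := by lia
    simp [qPoch]
  | succ M ih =>
    intro N hN v hv
    have hM : 1 - q ^ (M + 1) ≠ 0 := by
      have := hq (M + 1)
      rw [qPoch_succ] at this
      have := right_ne_zero_of_mul this
      rwa [pow_succ']
    have hv1 : ∀ i ≤ M, 1 - v * q ^ i ≠ 0 := fun i hi ↦ hv i (by lia)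
    have hv2 : ∀ i ≤ M, 1 - v * q * q ^ i ≠ 0 := fun i hi ↦ by
      have := hv (i + 1) (by lia)
      rwa [pow_succ', ← mul_assoc] at this
    have e0 : 1 - v ≠ 0 := by simpa using hv 0 (by lia)
    have e1 : 1 - v * q ^ (M + 1) ≠ 0 := hv (M + 1) le_rfl
    have hP : qPoch (v * q) q M ≠ 0 := qPoch_ne_zero fun j hj ↦ hv2 j hj.le
    have p1 : qPoch v q (M + 1) = (1 - v) * qPoch (v * q) q M := qPoch_succ' ..
    have p2 : qPoch v q (M + 1 + 1) = (1 - v) * qPoch (v * q) q M * (1 - v * q ^ (M + 1)) := by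
      rw [qPoch_succ, p1]
    have p3 : qPoch (v * q) q (M + 1) = qPoch (v * q) q M * (1 - v * q ^ (M + 1)) := by
      rw [qPoch_succ]
      ring
    apply mul_left_cancel₀ hM
    rcases N with _ | N
    · rw [q_pascal_sum hq, ih 0 (by lia) v hv1]
      have : ∑ i ∈ Finset.range (M + 1), q ^ (M - i) *
          ((-1) ^ (i + 1) * q ^ ((i + 1 + 1).choose 2) / (q ^ 0) ^ (i + 1) /
            (1 - v * q ^ (i + 1))) / (qPoch q q i * qPoch q q (M - i)) =
          -q ^ (M + 1) * ((v * q) ^ 0 / qPoch (v * q) q (M + 1)) := by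
        rw [← ih 0 (by lia) (v * q) hv2, Finset.mul_sum]
        refine Finset.sum_congr rfl fun i hi ↦ ?_
        have hi' : i ≤ M := by simpa [Nat.lt_succ_iff] using hi
        have : q ^ (M + 1) = q ^ (M - i) * q ^ (i + 1) := by
          rw [← pow_add]
          congr 1
          lia
        rw [this, Nat.choose_succ_succ' (i + 1) 1, Nat.choose_one_right]
        simp only [pow_zero, one_pow]
        ring
      rw [this, p1, p2, p3]
      field_simp
      ring
    · rw [q_pascal_sum' hq]
      have h1 : ∑ i ∈ Finset.range (M + 1), q ^ i *
          ((-1) ^ i * q ^ ((i + 1).choose 2) / (q ^ (N + 1)) ^ i /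
            (1 - v * q ^ i)) / (qPoch q q i * qPoch q q (M - i)) =
          v ^ N / qPoch v q (M + 1) := by
        rw [← ih N (by lia) v hv1]
        refine Finset.sum_congr rfl fun i hi ↦ ?_
        congr 1
        rw [pow_succ q N, mul_pow]
        field_simp
      have h2 : ∑ i ∈ Finset.range (M + 1),
          ((-1) ^ (i + 1) * q ^ ((i + 1 + 1).choose 2) / (q ^ (N + 1)) ^ (i + 1) /
            (1 - v * q ^ (i + 1))) / (qPoch q q i * qPoch q q (M - i)) =
          -(q ^ N)⁻¹ * ((v * q) ^ N / qPoch (v * q) q (M + 1)) := by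
        rw [← ih N (by lia) (v * q) hv2, Finset.mul_sum]
        refine Finset.sum_congr rfl fun i hi ↦ ?_
        rw [← mul_div_assoc]
        congr 1
        rw [Nat.choose_succ_succ' (i + 1) 1, Nat.choose_one_right, pow_succ q N, mul_pow,
          pow_succ' q i, ← mul_assoc v q, pow_add q, pow_succ' (-1 : ℂ), pow_succ' (q ^ N),
          pow_succ' q i]
        field_simp
      rw [h1, h2, p1, p2, p3]
      field_simp
      ring

lemma qPoch_div_pow {q w : ℂ} (hq0 : q ≠ 0) (hw0 : w ≠ 0) (N : ℕ) :
    qPoch (w / q ^ N) q N =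
      (-1) ^ N * q ^ (N.choose 2) * (w / q ^ N) ^ N * qPoch (q / w) q N := by
  induction N with
  | zero => simp [qPoch]
  | succ N ih =>
    rw [qPoch_succ', qPoch_succ, show w / q ^ (N + 1) * q = w / q ^ N by rw [pow_succ]; field_simp, ih,
      Nat.choose_succ_succ' N 1, Nat.choose_one_right]
    have : 1 - w / q ^ (N + 1) = -(w / q ^ (N + 1)) * (1 - q / w * q ^ N) := by
      field_simp
      ring
    have h2 : (w / q ^ N) ^ N = q ^ N * (w / q ^ (N + 1)) ^ N := by
      rw [← mul_pow]
      congr 1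
      rw [pow_succ]
      field_simp
    rw [this, h2]
    ring

lemma int_mul_succ_div_two (i N : ℕ) :
    ((i : ℤ) - N) * ((i : ℤ) - N + 1) / 2 = ((i + 1).choose 2 : ℤ) + (N.choose 2 : ℤ) - N * i := by
  have key (n : ℕ) : ((n.choose 2 : ℕ) : ℤ) * 2 = n * (n - 1) := by
    induction n with
    | zero => simp
    | succ n ih =>
      rw [Nat.choose_succ_succ' n 1, Nat.choose_one_right]
      push_cast
      linarith
  apply Int.ediv_eq_of_eq_mul_left (by norm_num)
  have h1 := key (i + 1)
  have h2 := key N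
  push_cast at h1
  linear_combination -h1 - h2

/-- Finite form of the Lambert series expansion. -/
lemma finite_lambert {q w : ℂ} (hq0 : q ≠ 0) (hq : ∀ n, qPoch q q n ≠ 0) (hw0 : w ≠ 0)
    (hw : ∀ n : ℤ, 1 - w * q ^ n ≠ 0) (N : ℕ) :
    ∑ k ∈ Finset.Icc (-N : ℤ) N, (-1 : ℂ) ^ k * q ^ (k * (k + 1) / 2) / (1 - w * q ^ k) /
        (qPoch q q (N + k).toNat * qPoch q q (N - k).toNat) =
      1 / (qPoch w q (N + 1) * qPoch (q / w) q N) := by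
  have hz (i : ℕ) : w / q ^ N * q ^ i = w * q ^ ((i : ℤ) - N) := by
    rw [zpow_sub₀ hq0, zpow_natCast, zpow_natCast]
    ring
  have hv : ∀ i ≤ 2 * N, 1 - w / q ^ N * q ^ i ≠ 0 := fun i _ ↦ by
    rw [hz]
    exact hw _
  have h := partial_fraction_qPoch hq0 hq (2 * N) N (by lia) (w / q ^ N) hv
  have hP : qPoch (w / q ^ N) q (2 * N + 1) ≠ 0 := qPoch_ne_zero fun j hj ↦ hv j (by lia)
  have hfac : qPoch (w / q ^ N) q (2 * N + 1) = (-1) ^ N * q ^ (N.choose 2) * (w / q ^ N) ^ N *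
      qPoch (q / w) q N * qPoch w q (N + 1) := by
    rw [show 2 * N + 1 = N + (N + 1) by ring, qPoch_add, qPoch_div_pow hq0 hw0,
      show w / q ^ N * q ^ N = w by field_simp]
  calc
    _ = ∑ i ∈ Finset.range (2 * N + 1), (-1) ^ N * q ^ (N.choose 2) *
        ((-1) ^ i * q ^ ((i + 1).choose 2) / (q ^ N) ^ i /
        (1 - w / q ^ N * q ^ i) / (qPoch q q i * qPoch q q (2 * N - i))) := by
      refine Finset.sum_nbij' (fun k ↦ (N + k).toNat) (fun i ↦ (i : ℤ) - N) ?_ ?_ ?_ ?_ ?_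
      · intro k hk
        simp only [Finset.mem_Icc, Finset.mem_range] at hk ⊢
        lia
      · intro i hi
        simp only [Finset.mem_Icc, Finset.mem_range] at hi ⊢
        lia
      · intro k hk
        simp only [Finset.mem_Icc] at hk ⊢
        lia
      · intro i hi
        simp
      · intro k hk
        simp only [Finset.mem_Icc] at hk
        obtain ⟨i, rfl⟩ : ∃ i : ℕ, k = (i : ℤ) - N := ⟨(N + k).toNat, by lia⟩
        rw [show (N + ((i : ℤ) - N)).toNat = i by lia,
          show (N - ((i : ℤ) - N)).toNat = 2 * N - i by lia, hz, ← mul_div_assoc, ← mul_div_assoc,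
          int_mul_succ_div_two]
        congr 2
        rw [zpow_sub₀ hq0, zpow_add₀ hq0, zpow_sub₀ (by norm_num)]
        have : (q : ℂ) ^ ((N : ℤ) * i) = (q ^ N) ^ i := by rw [zpow_mul]; simp
        rw [this]
        simp only [zpow_natCast]
        rcases neg_one_pow_eq_or ℂ N with h | h <;> rw [h] <;> field_simp
    _ = (-1) ^ N * q ^ (N.choose 2) * ((w / q ^ N) ^ N / qPoch (w / q ^ N) q (2 * N + 1)) := by
      rw [← Finset.mul_sum, h]
    _ = _ := by
      rw [hfac] at hP ⊢
      have c1 := right_ne_zero_of_mul hP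
      have c2 := right_ne_zero_of_mul (left_ne_zero_of_mul hP)
      have c3 : w / q ^ N ≠ 0 := by positivity
      generalize w / q ^ N = v at *
      field_simp

lemma summable_norm_mul_pow {q : ℂ} (hq : ‖q‖ < 1) (a : ℂ) :
    Summable fun j : ℕ ↦ ‖-(a * q ^ j)‖ := by
  simpa using (summable_geometric_of_lt_one (norm_nonneg q) hq).mul_left ‖a‖

lemma tendsto_qPoch {q : ℂ} (hq : ‖q‖ < 1) (a : ℂ) :
    Filter.Tendsto (qPoch a q) Filter.atTop (nhds (qPochInf a q)) := by
  have := (multipliable_one_add_of_summable (summable_norm_mul_pow hq a)).hasProd.tendsto_prod_nat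
  simp only [← sub_eq_add_neg] at this
  exact this

lemma qPochInf_ne_zero {q : ℂ} (hq : ‖q‖ < 1) {a : ℂ} (h : ∀ j : ℕ, 1 - a * q ^ j ≠ 0) :
    qPochInf a q ≠ 0 := by
  have := tprod_one_add_ne_zero_of_summable (f := fun j : ℕ ↦ -(a * q ^ j))
    (by simpa only [← sub_eq_add_neg] using h) (summable_norm_mul_pow hq a)
  simp only [← sub_eq_add_neg] at this
  exact this

lemma exists_norm_inv_le_of_tendsto {u : ℕ → ℂ} {x : ℂ}
    (hu : Filter.Tendsto (fun n ↦ (u n)⁻¹) Filter.atTop (nhds x)) :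
    ∃ C, ∀ n, ‖(u n)⁻¹‖ ≤ C := by
  obtain ⟨C, hC⟩ := (Metric.isBounded_range_of_tendsto _ hu).exists_norm_le
  exact ⟨C, fun n ↦ hC _ ⟨n, rfl⟩⟩

lemma exists_norm_inv_one_sub_le {q w : ℂ} (hq0 : q ≠ 0) (hq : ‖q‖ < 1) (hw0 : w ≠ 0) :
    ∃ C, ∀ k : ℤ, ‖(1 - w * q ^ k)⁻¹‖ ≤ C := by
  have t := tendsto_pow_atTop_nhds_zero_of_norm_lt_one hq
  obtain ⟨C₁, h₁⟩ := exists_norm_inv_le_of_tendsto (u := fun n ↦ 1 - w * q ^ n) (x := (1 - w * 0)⁻¹)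
    ((tendsto_const_nhds.sub (t.const_mul w)).inv₀ (by simp))
  obtain ⟨C₂, h₂⟩ := exists_norm_inv_le_of_tendsto (u := fun n ↦ 1 - w * (q ^ n)⁻¹)
    (x := 0 * (0 - w)⁻¹) (by
      have : Filter.Tendsto (fun n : ℕ ↦ q ^ n * (q ^ n - w)⁻¹) Filter.atTop
          (nhds (0 * (0 - w)⁻¹)) := t.mul ((t.sub tendsto_const_nhds).inv₀ (by simpa using hw0))
      refine this.congr fun n ↦ ?_
      have : 1 - w * (q ^ n)⁻¹ = (q ^ n - w) * (q ^ n)⁻¹ := by field_simp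
      rw [this, mul_inv, inv_inv, mul_comm])
  refine ⟨max C₁ C₂, fun k ↦ ?_⟩
  obtain ⟨n, rfl | rfl⟩ := k.eq_nat_or_neg
  · simpa using Or.inl (h₁ n)
  · simpa using Or.inr (h₂ n)

lemma summable_pow_triangular {r : ℝ} (h0 : 0 ≤ r) (h1 : r < 1) :
    Summable fun k : ℤ ↦ r ^ (k * (k + 1) / 2) := by
  have hg := summable_geometric_of_lt_one h0 h1
  have tri (n : ℕ) : ((n : ℤ) * (n + 1) / 2) = ((n + 1).choose 2 : ℕ) := by
    simpa using int_mul_succ_div_two n 0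
  have hle (n : ℕ) : n ≤ (n + 1).choose 2 := by
    rw [Nat.choose_succ_succ' n 1, Nat.choose_one_right]
    lia
  have hs : Summable fun n : ℕ ↦ r ^ ((n : ℤ) * (n + 1) / 2) := by
    refine hg.of_nonneg_of_le (fun n ↦ zpow_nonneg h0 _) fun n ↦ ?_
    rw [tri, zpow_natCast]
    exact pow_le_pow_of_le_one h0 h1.le (hle n)
  refine .of_nat_of_neg_add_one hs ?_
  convert hs using 4 with n
  ring

/-- the Lambert series expansion of the theta quotient. -/
theorem lambert_theta_quotient (τ : ℂ) (hτ : 0 < τ.im) (q : ℂ)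
    (hq : q = Complex.exp (2 * Real.pi * Complex.I * τ))
    (w : ℂ) (hw0 : w ≠ 0) (hw : ∀ n : ℤ, w ≠ q ^ n) :
    ∑' n : ℤ, (-1 : ℂ) ^ n * q ^ (n * (n + 1) / 2) / (1 - w * q ^ n) =
      qPochInf q q ^ 2 / (qPochInf w q * qPochInf (q / w) q) := by
  have hq1 : ‖q‖ < 1 := by
    rw [hq, Complex.norm_exp, Real.exp_lt_one_iff]
    have : (2 * Real.pi * Complex.I * τ).re = -(2 * Real.pi * τ.im) := by simp
    rw [this]
    have := Real.pi_pos
    simp only [Left.neg_neg_iff]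
    positivity
  have hq0 : q ≠ 0 := hq ▸ Complex.exp_ne_zero _
  clear hq
  have hqj (j : ℕ) : 1 - q * q ^ j ≠ 0 := fun h ↦ by
    have h' : q ^ (j + 1) = 1 := by
      rw [pow_succ']
      exact (sub_eq_zero.mp h).symm
    have := congrArg norm h'
    rw [norm_pow, norm_one] at this
    exact (pow_lt_one₀ (norm_nonneg q) hq1 j.succ_ne_zero).ne this
  have hP (n : ℕ) : qPoch q q n ≠ 0 := qPoch_ne_zero fun j _ ↦ hqj j
  have hwk (k : ℤ) : 1 - w * q ^ k ≠ 0 := fun h ↦ hw (-k) <| by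
    rw [zpow_neg]
    exact eq_inv_of_mul_eq_one_left (sub_eq_zero.mp h).symm
  have hw1 : qPochInf w q ≠ 0 := qPochInf_ne_zero hq1 fun j ↦ by simpa using hwk j
  have hw2 : qPochInf (q / w) q ≠ 0 := qPochInf_ne_zero hq1 fun j h ↦ hw (j + 1 : ℕ) <| by
    rw [zpow_natCast]
    field_simp at h
    linear_combination h
  have hQ : qPochInf q q ≠ 0 := qPochInf_ne_zero hq1 hqj
  have tQ := (tendsto_qPoch hq1 q).inv₀ hQ
  obtain ⟨A, hA⟩ := exists_norm_inv_le_of_tendsto tQ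
  obtain ⟨B, hB⟩ := exists_norm_inv_one_sub_le hq0 hq1 hw0
  have hA0 : 0 ≤ A := (norm_nonneg _).trans (hA 0)
  let c : ℤ → ℂ := fun k ↦ (-1 : ℂ) ^ k * q ^ (k * (k + 1) / 2) / (1 - w * q ^ k)
  let f : ℕ → ℤ → ℂ := fun N k ↦ if k ∈ Finset.Icc (-N : ℤ) N then
    c k / (qPoch q q (N + k).toNat * qPoch q q (N - k).toNat) else 0
  have hc (k : ℤ) : ‖c k‖ ≤ B * ‖q‖ ^ (k * (k + 1) / 2) := by
    simp only [c, div_eq_mul_inv, norm_mul, norm_zpow, norm_neg, norm_one, one_zpow, one_mul]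
    rw [mul_comm]
    exact mul_le_mul_of_nonneg_right (hB k) (by positivity)
  have hf (N : ℕ) : ∑' k, f N k = 1 / (qPoch w q (N + 1) * qPoch (q / w) q N) := by
    rw [← finite_lambert hq0 hP hw0 hwk N,
      tsum_eq_sum (s := Finset.Icc (-N : ℤ) N) fun k hk ↦ if_neg hk]
    exact Finset.sum_congr rfl fun k hk ↦ if_pos hk
  have lim₁ : Filter.Tendsto (fun N ↦ ∑' k, f N k) Filter.atTop
      (nhds (1 / (qPochInf w q * qPochInf (q / w) q))) := by
    simp only [hf]
    exact tendsto_const_nhds.div (((tendsto_qPoch hq1 w).comp (Filter.tendsto_add_atTop_nat 1)).mul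
      (tendsto_qPoch hq1 (q / w))) (mul_ne_zero hw1 hw2)
  have lim₂ : Filter.Tendsto (fun N ↦ ∑' k, f N k) Filter.atTop
      (nhds (∑' k, c k / (qPochInf q q * qPochInf q q))) := by
    refine tendsto_tsum_of_dominated_convergence
      (bound := fun k ↦ B * ‖q‖ ^ (k * (k + 1) / 2) * (A * A))
      (((summable_pow_triangular (norm_nonneg q) hq1).mul_left B).mul_right _) (fun k ↦ ?_) ?_
    · have t₁ : Filter.Tendsto (fun N : ℕ ↦ (N + k).toNat) Filter.atTop Filter.atTop :=
        Filter.tendsto_atTop.mpr fun b ↦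
          (Filter.eventually_ge_atTop (b + k.natAbs)).mono fun N hN ↦ by lia
      have t₂ : Filter.Tendsto (fun N : ℕ ↦ (N - k).toNat) Filter.atTop Filter.atTop :=
        Filter.tendsto_atTop.mpr fun b ↦
          (Filter.eventually_ge_atTop (b + k.natAbs)).mono fun N hN ↦ by lia
      refine (tendsto_const_nhds.div (((tendsto_qPoch hq1 q).comp t₁).mul
        ((tendsto_qPoch hq1 q).comp t₂)) (mul_ne_zero hQ hQ)).congr' ?_
      filter_upwards [Filter.eventually_ge_atTop k.natAbs] with N hN
      have hk : k ∈ Finset.Icc (-N : ℤ) N := by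
        rw [Finset.mem_Icc]
        lia
      exact (if_pos hk).symm
    · refine Filter.Eventually.of_forall fun N k ↦ ?_
      have hB0 : 0 ≤ B * ‖q‖ ^ (k * (k + 1) / 2) := (norm_nonneg _).trans (hc k)
      by_cases hk : k ∈ Finset.Icc (-N : ℤ) N
      · simp only [f, if_pos hk, div_eq_mul_inv, mul_inv, norm_mul (c k)]
        refine mul_le_mul (hc k) ?_ (norm_nonneg _) hB0
        rw [norm_mul]
        exact mul_le_mul (hA _) (hA _) (norm_nonneg _) hA0
      · simp only [f, if_neg hk, norm_zero]
        positivity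
  have h := tendsto_nhds_unique lim₂ lim₁
  rw [tsum_div_const, div_eq_iff (mul_ne_zero hQ hQ)] at h
  rw [h]
  ring

end
end

section
/- For every integer m and every natural number n, N(3m−1,n) + N(3m,n) + N(3m+1,n) = Σ_{k ≥ 0, 3k ≤ n} M(m,k)·p_3(n−3k). -/
open Finset

noncomputable section

/-- The rank of a partition: largest part minus the number of parts. -/
def Nat.Partition.rank {n : ℕ} (p : n.Partition) : ℤ :=
  (p.parts.sup : ℤ) - p.parts.card

/-- `N m n`: the number of partitions of `n` with rank `m`. -/
def rankCount (m : ℤ) (n : ℕ) : ℕ :=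
  (Finset.univ.filter fun p : n.Partition => p.rank = m).card

/-- The crank of a partition. -/
def Nat.Partition.crank {n : ℕ} (p : n.Partition) : ℤ :=
  if p.parts.count 1 = 0 then (p.parts.sup : ℤ)
  else ((p.parts.filter fun x => p.parts.count 1 < x).card : ℤ) - p.parts.count 1

/-- `M m n`: the number of partitions of `n` with crank `m`, with the special
convention at `n = 1`. -/
def crankCount (m : ℤ) (n : ℕ) : ℤ :=
  if n = 1 then (if m = 0 then -1 else if m = 1 ∨ m = -1 then 1 else 0)
  else ((Finset.univ.filter fun p : n.Partition => p.crank = m).card : ℤ)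

/-- `p₃ n`: the number of partitions of `n` into parts congruent to `±1` mod `3`. -/
def p3 (n : ℕ) : ℕ :=
  (Finset.univ.filter fun p : n.Partition =>
    ∀ x ∈ p.parts, x % 3 = 1 ∨ x % 3 = 2).card

/-- `N(t,6,n)`: the number of partitions of `n` with rank congruent to `t` mod `6`. -/
def rankCountMod6 (t : ℤ) (n : ℕ) : ℕ :=
  (Finset.univ.filter fun p : n.Partition => p.rank % 6 = t % 6).card

/-- `M(t,2,n) = Σ_{m ≡ t (mod 2)} M(m,n)` (a finite sum, since the crank of a
partition of `n` lies in `[-n, n]`). -/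
def crankCountMod2 (t : ℤ) (n : ℕ) : ℤ :=
  ∑ m ∈ Finset.Icc (-(n : ℤ)) (n : ℤ), if m % 2 = t % 2 then crankCount m n else 0

def N6 (n : ℕ) : ℤ :=
  (rankCountMod6 0 n + rankCountMod6 1 n + rankCountMod6 5 n : ℤ)
    - rankCountMod6 2 n - rankCountMod6 3 n - rankCountMod6 4 n

def M2 (n : ℕ) : ℤ := crankCountMod2 0 n - crankCountMod2 1 n

open scoped Classical in
/-- The number of partitions of `n` whose multiset of parts satisfies `Q`. -/
def partitionCount (n : ℕ) (Q : Multiset ℕ → Prop) : ℕ :=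
  (Finset.univ.filter fun p : n.Partition => Q p.parts).card

theorem partitionCount_congr_of_inverse {n n' : ℕ} {Q Q' : Multiset ℕ → Prop}
    (i j : Multiset ℕ → Multiset ℕ)
    (hi : ∀ s, (∀ x ∈ s, 0 < x) → s.sum = n → Q s →
      (∀ x ∈ i s, 0 < x) ∧ (i s).sum = n' ∧ Q' (i s) ∧ j (i s) = s)
    (hj : ∀ s, (∀ x ∈ s, 0 < x) → s.sum = n' → Q' s →
      (∀ x ∈ j s, 0 < x) ∧ (j s).sum = n ∧ Q (j s) ∧ i (j s) = s) :
    partitionCount n Q = partitionCount n' Q' := by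
  classical
  have hi' : ∀ p : n.Partition, Q p.parts → _ := fun p =>
    hi p.parts (fun _ h => p.parts_pos h) p.parts_sum
  have hj' : ∀ p : n'.Partition, Q' p.parts → _ := fun p =>
    hj p.parts (fun _ h => p.parts_pos h) p.parts_sum
  refine Finset.card_bij'
    (fun p hp => ⟨i p.parts, fun h => (hi' p (by simpa using hp)).1 _ h,
      (hi' p (by simpa using hp)).2.1⟩)
    (fun p hp => ⟨j p.parts, fun h => (hj' p (by simpa using hp)).1 _ h,
      (hj' p (by simpa using hp)).2.1⟩) ?_ ?_ ?_ ?_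
  · intro p hp
    simpa using (hi' p (by simpa using hp)).2.2.1
  · intro p hp
    simpa using (hj' p (by simpa using hp)).2.2.1
  · intro p hp
    exact Nat.Partition.ext (hi' p (by simpa using hp)).2.2.2
  · intro p hp
    exact Nat.Partition.ext (hj' p (by simpa using hp)).2.2.2

theorem partitionCount_congr {n : ℕ} {Q Q' : Multiset ℕ → Prop}
    (h : ∀ s, (∀ x ∈ s, 0 < x) → s.sum = n → (Q s ↔ Q' s)) :
    partitionCount n Q = partitionCount n Q' :=
  partitionCount_congr_of_inverse id id (fun s h1 h2 h3 => ⟨h1, h2, (h s h1 h2).1 h3, rfl⟩)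
    (fun s h1 h2 h3 => ⟨h1, h2, (h s h1 h2).2 h3, rfl⟩)

theorem partitionCount_and_add_and_not (n : ℕ) (Q R : Multiset ℕ → Prop) :
    partitionCount n (fun s => Q s ∧ R s) + partitionCount n (fun s => Q s ∧ ¬ R s) =
      partitionCount n Q := by
  classical
  simp only [partitionCount]
  rw [← Finset.card_filter_add_card_filter_not
    (s := Finset.univ.filter fun p : n.Partition => Q p.parts) (fun p => R p.parts),
    Finset.filter_filter, Finset.filter_filter]

theorem partitionCount_eq_zero {n : ℕ} {Q : Multiset ℕ → Prop}
    (h : ∀ s, (∀ x ∈ s, 0 < x) → s.sum = n → ¬ Q s) : partitionCount n Q = 0 := by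
  classical
  simp only [partitionCount, Finset.card_eq_zero, Finset.filter_eq_empty_iff]
  exact fun p _ => h _ (fun _ h => p.parts_pos h) p.parts_sum

/-- The number of elements larger than `d`. -/
def Multiset.countAbove (d : ℕ) (s : Multiset ℕ) : ℕ := (s.filter (d < ·)).card

/-- Decrease all elements larger than `d` by one and drop the zeros. -/
def Multiset.lowerAbove (d : ℕ) (s : Multiset ℕ) : Multiset ℕ :=
  (s.map fun x => if d < x then x - 1 else x).filter (0 < ·)

/-- Increase the `l` largest elements by one, the `l`-th largest element being `d`. -/
def Multiset.raiseTop (d l : ℕ) (s : Multiset ℕ) : Multiset ℕ :=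
  (s.filter (d < ·)).map (· + 1) + Multiset.replicate (l - s.countAbove d) (d + 1) +
    (s.filter (· ≤ d) - Multiset.replicate (l - s.countAbove d) d)

namespace Multiset

theorem countAbove_nil (d : ℕ) : (0 : Multiset ℕ).countAbove d = 0 := rfl

theorem countAbove_cons (d a : ℕ) (s : Multiset ℕ) :
    (a ::ₘ s).countAbove d = s.countAbove d + if d < a then 1 else 0 := by
  simp only [countAbove, filter_cons]
  split_ifs <;> simp [add_comm]

theorem countAbove_add (d : ℕ) (s t : Multiset ℕ) :
    (s + t).countAbove d = s.countAbove d + t.countAbove d := by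
  simp [countAbove]

theorem countAbove_replicate (d k a : ℕ) :
    (replicate k a).countAbove d = if d < a then k else 0 := by
  induction k with
  | zero => simp [countAbove]
  | succ k ih => rw [replicate_succ, countAbove_cons, ih]; split_ifs <;> simp

theorem countAbove_eq_add_count (d : ℕ) (s : Multiset ℕ) :
    s.countAbove d = s.countAbove (d + 1) + s.count (d + 1) := by
  induction s using Multiset.induction_on with
  | empty => simp [countAbove]
  | cons a s ih =>
    rw [countAbove_cons, countAbove_cons, count_cons, ih]
    split_ifs <;> omega

theorem countAbove_le_card (d : ℕ) (s : Multiset ℕ) : s.countAbove d ≤ s.card :=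
  card_le_card (filter_le _ _)

theorem countAbove_zero {s : Multiset ℕ} (hs : ∀ x ∈ s, 0 < x) : s.countAbove 0 = s.card := by
  rw [countAbove, filter_eq_self.2 hs]

theorem lowerAbove_cons (d a : ℕ) (s : Multiset ℕ) :
    (a ::ₘ s).lowerAbove d =
      (if 0 < (if d < a then a - 1 else a) then {if d < a then a - 1 else a} else 0) +
        s.lowerAbove d := by
  simp only [lowerAbove, map_cons, filter_cons]

theorem pos_of_mem_lowerAbove {d : ℕ} {s : Multiset ℕ} : ∀ x ∈ s.lowerAbove d, 0 < x :=
  fun _ hx => (mem_filter.1 hx).2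

theorem count_lowerAbove (d : ℕ) (s : Multiset ℕ) {a : ℕ} (ha : 0 < a) :
    (s.lowerAbove d).count a =
      (if a ≤ d then s.count a else 0) + if d ≤ a then s.count (a + 1) else 0 := by
  induction s using Multiset.induction_on with
  | empty => simp [lowerAbove]
  | cons b s ih =>
    rw [lowerAbove_cons, count_add, ih, count_cons, count_cons]
    split_ifs <;> simp only [count_singleton, count_zero] <;> (try split_ifs) <;> omega

theorem countAbove_lowerAbove (d : ℕ) (s : Multiset ℕ) {e : ℕ} (h : d ≤ e) :
    (s.lowerAbove d).countAbove e = s.countAbove (e + 1) := by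
  induction s using Multiset.induction_on with
  | empty => simp [lowerAbove, countAbove]
  | cons b s ih =>
    rw [lowerAbove_cons, countAbove_add, ih, countAbove_cons, ← replicate_one]
    split_ifs <;> simp only [countAbove_replicate, countAbove_nil] <;>
      (try split_ifs) <;> omega

theorem countAbove_lowerAbove_of_lt (d : ℕ) (s : Multiset ℕ) {e : ℕ} (h : e < d) :
    (s.lowerAbove d).countAbove e = s.countAbove e := by
  induction s using Multiset.induction_on with
  | empty => simp [lowerAbove, countAbove]
  | cons b s ih =>
    rw [lowerAbove_cons, countAbove_add, ih, countAbove_cons, ← replicate_one]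
    split_ifs <;> simp only [countAbove_replicate, countAbove_nil] <;>
      (try split_ifs) <;> omega

theorem sum_lowerAbove (d : ℕ) (s : Multiset ℕ) :
    (s.lowerAbove d).sum + s.countAbove d = s.sum := by
  induction s using Multiset.induction_on with
  | empty => simp [lowerAbove, countAbove]
  | cons b s ih =>
    rw [lowerAbove_cons, sum_add, sum_cons, countAbove_cons]
    split_ifs <;> simp only [sum_singleton, sum_zero] <;> omega

theorem count_raiseTop (d l : ℕ) (s : Multiset ℕ) (a : ℕ) :
    (s.raiseTop d l).count a =
      (if d + 1 < a then s.count (a - 1) else 0) + (if a = d + 1 then l - s.countAbove d else 0) +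
        if a ≤ d then s.count a - (if a = d then l - s.countAbove d else 0) else 0 := by
  have h : ((s.filter (d < ·)).map (· + 1)).count a = if d + 1 < a then s.count (a - 1) else 0 := by
    rcases a with _ | a
    · simp
    · rw [count_map_eq_count' _ _ (add_left_injective 1)]
      simp [count_filter]
  rw [raiseTop, count_add, count_add, h, count_sub, count_replicate, count_replicate, count_filter]
  congr 1
  · congr 1; simp only [eq_comm]
  · split_ifs <;> first | rfl | omega

theorem countAbove_raiseTop {d l : ℕ} {s : Multiset ℕ} (h : s.countAbove d ≤ l) :
    (s.raiseTop d l).countAbove d = l := by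
  rw [raiseTop, countAbove_add, countAbove_add, countAbove_replicate, if_pos (Nat.lt_succ_self d)]
  have h1 : (filter (· ≤ d) s - replicate (l - s.countAbove d) d).countAbove d = 0 := by
    rw [countAbove, card_eq_zero, filter_eq_nil]
    intro a ha
    have := (mem_filter.1 (mem_of_le (Multiset.sub_le_self _ _) ha)).2
    omega
  have h2 : (map (· + 1) (filter (d < ·) s)).countAbove d = s.countAbove d := by
    rw [countAbove, filter_eq_self.2, card_map, countAbove]
    intro a ha
    obtain ⟨b, hb, rfl⟩ := mem_map.1 ha
    have := (mem_filter.1 hb).2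
    omega
  omega

theorem pos_of_mem_raiseTop {d l : ℕ} {s : Multiset ℕ} (hs : ∀ x ∈ s, 0 < x) :
    ∀ x ∈ s.raiseTop d l, 0 < x := by
  intro x hx
  rw [raiseTop, mem_add, mem_add] at hx
  rcases hx with (hx | hx) | hx
  · obtain ⟨b, -, rfl⟩ := mem_map.1 hx
    omega
  · rw [eq_of_mem_replicate hx]; omega
  · exact hs x (mem_filter.1 (mem_of_le (Multiset.sub_le_self _ _) hx)).1

theorem raiseTop_lowerAbove {d : ℕ} {s : Multiset ℕ} (hs : ∀ x ∈ s, 0 < x) :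
    (s.lowerAbove d).raiseTop d (s.countAbove d) = s := by
  ext a
  have h0 : s.count 0 = 0 := count_eq_zero.2 fun h => (hs 0 h).false
  have h0' : (s.lowerAbove d).count 0 = 0 :=
    count_eq_zero.2 fun h => (pos_of_mem_lowerAbove 0 h).false
  rw [count_raiseTop, countAbove_lowerAbove _ _ le_rfl, countAbove_eq_add_count d s]
  rcases Nat.eq_zero_or_pos a with rfl | ha
  · simp [h0, h0']
  · rw [count_lowerAbove _ _ ha]
    by_cases h : d + 1 < a
    · rw [count_lowerAbove _ _ (by omega)]
      have : a - 1 + 1 = a := by omega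
      rw [this]
      split_ifs <;> omega
    · by_cases h' : a = d + 1
      · subst h'; split_ifs <;> omega
      · by_cases h'' : a = d
        · subst h''; split_ifs <;> omega
        · split_ifs <;> omega

theorem lowerAbove_raiseTop {d l : ℕ} {s : Multiset ℕ} (hs : ∀ x ∈ s, 0 < x)
    (h : s.countAbove d ≤ l) (h' : d ≠ 0 → l ≤ s.countAbove d + s.count d) :
    (s.raiseTop d l).lowerAbove d = s := by
  ext a
  rcases Nat.eq_zero_or_pos a with rfl | ha
  · rw [count_eq_zero.2 fun h => (hs 0 h).false,
      count_eq_zero.2 fun h => (pos_of_mem_lowerAbove 0 h).false]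
  · rw [count_lowerAbove _ _ ha, count_raiseTop, count_raiseTop, Nat.add_sub_cancel]
    by_cases h1 : a = d
    · subst h1
      have := h' (by omega)
      split_ifs <;> omega
    · split_ifs <;> omega

theorem sum_raiseTop {d l : ℕ} {s : Multiset ℕ} (hs : ∀ x ∈ s, 0 < x)
    (h : s.countAbove d ≤ l) (h' : d ≠ 0 → l ≤ s.countAbove d + s.count d) :
    (s.raiseTop d l).sum = s.sum + l := by
  rw [← sum_lowerAbove d, lowerAbove_raiseTop hs h h', countAbove_raiseTop h]

/-- Insert an element, unless it is zero. -/
def insertPos (a : ℕ) (s : Multiset ℕ) : Multiset ℕ := if a = 0 then s else a ::ₘ s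

theorem pos_of_mem_insertPos {a : ℕ} {s : Multiset ℕ} (hs : ∀ x ∈ s, 0 < x) :
    ∀ x ∈ s.insertPos a, 0 < x := by
  intro x hx
  rw [insertPos] at hx
  split_ifs at hx with h
  · exact hs x hx
  · rcases mem_cons.1 hx with rfl | hx
    · omega
    · exact hs x hx

theorem sum_insertPos (a : ℕ) (s : Multiset ℕ) : (s.insertPos a).sum = a + s.sum := by
  rw [insertPos]
  split_ifs with h <;> simp [h]

theorem countAbove_insertPos (d a : ℕ) (s : Multiset ℕ) :
    (s.insertPos a).countAbove d = s.countAbove d + if d < a then 1 else 0 := by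
  rw [insertPos]
  split_ifs with h h' h' <;> simp_all [countAbove_cons]

theorem erase_insertPos {a : ℕ} {s : Multiset ℕ} (hs : ∀ x ∈ s, 0 < x) :
    (s.insertPos a).erase a = s := by
  rw [insertPos]
  split_ifs with h
  · exact erase_of_notMem fun h' => by have := hs _ h'; omega
  · exact erase_cons_head _ _

theorem insertPos_erase {a : ℕ} {s : Multiset ℕ} (hs : ∀ x ∈ s, 0 < x) (h : a ≠ 0 → a ∈ s) :
    (s.erase a).insertPos a = s := by
  rw [insertPos]
  split_ifs with h'
  · exact erase_of_notMem fun h' => by have := hs _ h'; omega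
  · exact cons_erase (h h')

end Multiset

theorem Multiset.sup_mem {s : Multiset ℕ} (h : s.sup ≠ 0) : s.sup ∈ s := by
  induction s using Multiset.induction_on with
  | empty => simp at h
  | cons a s ih =>
    rw [Multiset.sup_cons] at h ⊢
    rcases le_total a s.sup with h' | h'
    · rw [sup_eq_right.2 h'] at h ⊢
      exact Multiset.mem_cons_of_mem (ih h)
    · rw [sup_eq_left.2 h']
      exact Multiset.mem_cons_self _ _

theorem Multiset.card_le_sum_of_pos {s : Multiset ℕ} (hs : ∀ x ∈ s, 0 < x) : s.card ≤ s.sum := by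
  simpa using Multiset.card_nsmul_le_sum (a := 1) hs

theorem Multiset.le_of_mem_lowerAbove_zero {s : Multiset ℕ} {x : ℕ} (h : x ∈ s.lowerAbove 0) :
    x + 1 ≤ s.sup := by
  obtain ⟨h1, h2⟩ := Multiset.mem_filter.1 h
  obtain ⟨b, hb, rfl⟩ := Multiset.mem_map.1 h1
  have := Multiset.le_sup hb
  split_ifs at h2 ⊢ <;> omega

theorem Multiset.le_of_mem_raiseTop_zero {s : Multiset ℕ} {l x : ℕ} (h : x ∈ s.raiseTop 0 l) :
    x ≤ s.sup + 1 := by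
  rw [Multiset.raiseTop, Multiset.mem_add, Multiset.mem_add] at h
  rcases h with (h | h) | h
  · obtain ⟨b, hb, rfl⟩ := Multiset.mem_map.1 h
    have := Multiset.le_sup (Multiset.mem_filter.1 hb).1
    omega
  · rw [Multiset.eq_of_mem_replicate h]; omega
  · have := (Multiset.mem_filter.1 (Multiset.mem_of_le (Multiset.sub_le_self _ _) h)).2
    omega

/-- Dyson's symmetry: exchange the first column of a partition for a new first row. -/
theorem partitionCount_rank_le {n n' : ℕ} {r : ℤ} (h : (n' : ℤ) = n + r - 1) :
    partitionCount n (fun s => (s.sup : ℤ) - s.card ≤ r) =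
      partitionCount n' (fun s => r - 2 ≤ (s.sup : ℤ) - s.card) := by
  refine partitionCount_congr_of_inverse
    (fun s => (s.lowerAbove 0).insertPos (s.card + r - 1).toNat)
    (fun s => (s.erase s.sup).raiseTop 0 (s.sup - r + 1).toNat) ?_ ?_
  · intro s hs hn hr
    have hc := Multiset.countAbove_zero hs
    have hsum := Multiset.sum_lowerAbove 0 s
    have hb : 0 ≤ (s.card : ℤ) + r - 1 := by
      rcases Nat.eq_zero_or_pos s.sup with h0 | h0
      · have : s = 0 := Multiset.eq_zero_of_forall_notMem fun x hx => by
          have := Multiset.le_sup hx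
          have := hs x hx
          omega
        subst this
        simp at hn ⊢
        omega
      · omega
    have hcard : (s.lowerAbove 0).card ≤ s.card := by
      rw [← Multiset.countAbove_zero Multiset.pos_of_mem_lowerAbove,
        Multiset.countAbove_lowerAbove _ _ le_rfl]
      exact Multiset.countAbove_le_card _ _
    have hpos := Multiset.pos_of_mem_insertPos (a := (s.card + r - 1).toNat)
      (Multiset.pos_of_mem_lowerAbove (d := 0) (s := s))
    have hsup : ((s.lowerAbove 0).insertPos (s.card + r - 1).toNat).sup =
        (s.card + r - 1).toNat := by
      have h1 : (s.lowerAbove 0).sup ≤ (s.card + r - 1).toNat :=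
        Multiset.sup_le.2 fun x hx => by
          have := Multiset.le_of_mem_lowerAbove_zero hx
          omega
      rw [Multiset.insertPos]
      split_ifs with h0
      · omega
      · rw [Multiset.sup_cons, sup_eq_left.2 h1]
    refine ⟨hpos, ?_, ?_, ?_⟩
    · rw [Multiset.sum_insertPos]
      omega
    · rw [hsup, ← Multiset.countAbove_zero hpos, Multiset.countAbove_insertPos,
        Multiset.countAbove_zero Multiset.pos_of_mem_lowerAbove]
      split_ifs <;> omega
    · rw [hsup, Multiset.erase_insertPos Multiset.pos_of_mem_lowerAbove]
      have : (((s.card + r - 1).toNat : ℤ) - r + 1).toNat = s.countAbove 0 := by omega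
      rw [this, Multiset.raiseTop_lowerAbove hs]
  · intro s hs hn hr
    have hers : ∀ x ∈ s.erase s.sup, 0 < x := fun x hx => hs x (Multiset.mem_of_mem_erase hx)
    have hins : (s.erase s.sup).insertPos s.sup = s :=
      Multiset.insertPos_erase hs Multiset.sup_mem
    have hsum := Multiset.sum_insertPos s.sup (s.erase s.sup)
    have hcard := Multiset.countAbove_insertPos 0 s.sup (s.erase s.sup)
    rw [hins] at hsum hcard
    rw [Multiset.countAbove_zero hs] at hcard
    have hz : s.sup = 0 → s.card = 0 := fun h0 => by
      rw [Multiset.card_eq_zero]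
      exact Multiset.eq_zero_of_forall_notMem fun x hx => by
          have := Multiset.le_sup hx
          have := hs x hx
          omega
    have hz' : s.card = 0 → s.sum = 0 := fun h0 => by
      rw [Multiset.card_eq_zero.1 h0, Multiset.sum_zero]
    have hl : ((s.erase s.sup).countAbove 0 : ℤ) ≤ s.sup - r + 1 := by
      split_ifs at hcard with h0 <;> omega
    have hl' : (s.erase s.sup).countAbove 0 ≤ (s.sup - r + 1).toNat := by omega
    have hpos := Multiset.pos_of_mem_raiseTop (d := 0) (l := (s.sup - r + 1).toNat) hers
    have hc := Multiset.countAbove_raiseTop hl'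
    rw [Multiset.countAbove_zero hpos] at hc
    refine ⟨hpos, ?_, ?_, ?_⟩
    · rw [Multiset.sum_raiseTop hers hl' (by simp)]
      omega
    · have : ((s.erase s.sup).raiseTop 0 (s.sup - r + 1).toNat).sup ≤ s.sup + 1 :=
        Multiset.sup_le.2 fun x hx => (Multiset.le_of_mem_raiseTop_zero hx).trans <| by
          have := Multiset.sup_mono (Multiset.subset_of_le (Multiset.erase_le s.sup s))
          omega
      rw [hc]
      omega
    · rw [hc, Multiset.lowerAbove_raiseTop hers hl' (by simp)]
      have : (((s.sup - r + 1).toNat : ℕ) + r - 1).toNat = s.sup := by omega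
      rw [this, hins]

theorem partitionCount_card_eq (n k : ℕ) :
    partitionCount (n + k) (fun s => s.card = k) = partitionCount n (fun s => s.card ≤ k) := by
  refine partitionCount_congr_of_inverse (Multiset.lowerAbove 0) (Multiset.raiseTop 0 k) ?_ ?_
  · intro s hs hn hk
    have hc := Multiset.countAbove_zero hs
    refine ⟨Multiset.pos_of_mem_lowerAbove, ?_, ?_, ?_⟩
    · have := Multiset.sum_lowerAbove 0 s
      omega
    · rw [← Multiset.countAbove_zero Multiset.pos_of_mem_lowerAbove,
        Multiset.countAbove_lowerAbove _ _ le_rfl, ← hk]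
      exact Multiset.countAbove_le_card _ _
    · rw [← hk, ← hc, Multiset.raiseTop_lowerAbove hs]
  · intro s hs hn hk
    have hc := Multiset.countAbove_zero hs
    rw [← hc] at hk
    refine ⟨Multiset.pos_of_mem_raiseTop hs, ?_, ?_, ?_⟩
    · rw [Multiset.sum_raiseTop hs hk (by simp)]
      omega
    · rw [← Multiset.countAbove_zero (Multiset.pos_of_mem_raiseTop hs),
        Multiset.countAbove_raiseTop hk]
    · rw [Multiset.lowerAbove_raiseTop hs hk (by simp)]

theorem partitionCount_sup_eq (n k : ℕ) :
    partitionCount (n + (k + 1)) (fun s => s.sup = k + 1) =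
      partitionCount n (fun s => s.sup ≤ k + 1) := by
  refine partitionCount_congr_of_inverse (fun s => s.erase (k + 1)) (fun s => (k + 1) ::ₘ s) ?_ ?_
  · intro s hs hn hk
    have hmem : k + 1 ∈ s := hk ▸ Multiset.sup_mem (by omega)
    refine ⟨fun x hx => hs x (Multiset.mem_of_mem_erase hx), ?_, ?_, Multiset.cons_erase hmem⟩
    · have := Multiset.sum_erase hmem
      omega
    · exact (Multiset.sup_mono (Multiset.subset_of_le (Multiset.erase_le (k + 1) s))).trans hk.le
  · intro s hs hn hk
    refine ⟨?_, ?_, ?_, Multiset.erase_cons_head _ _⟩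
    · intro x hx
      rcases Multiset.mem_cons.1 hx with rfl | hx
      · omega
      · exact hs x hx
    · rw [Multiset.sum_cons]
      omega
    · rw [Multiset.sup_cons, sup_eq_left.2 hk]

/-- Conjugation exchanges the largest part and the number of parts. -/
theorem partitionCount_card_le_eq_sup_le (n k : ℕ) :
    partitionCount n (fun s => s.card ≤ k) = partitionCount n (fun s => s.sup ≤ k) := by
  induction k generalizing n with
  | zero =>
    refine partitionCount_congr fun s hs _ => ?_
    simp only [Nat.le_zero, Multiset.card_eq_zero]
    refine ⟨fun h => by simp [h], fun h => Multiset.eq_zero_of_forall_notMem fun x hx => ?_⟩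
    have := Multiset.le_sup hx
    have := hs x hx
    omega
  | succ k ih =>
    induction n using Nat.strong_induction_on with
    | _ n ihn =>
      rw [← partitionCount_and_add_and_not n (fun s => s.card ≤ k + 1) (fun s => s.card ≤ k),
        ← partitionCount_and_add_and_not n (fun s => s.sup ≤ k + 1) (fun s => s.sup ≤ k)]
      congr 1
      · rw [partitionCount_congr (Q' := fun s => s.card ≤ k) (fun s _ _ => by omega), ih]
        exact partitionCount_congr fun s _ _ => by omega
      · rw [partitionCount_congr (Q' := fun s => s.card = k + 1) (fun s _ _ => by omega),
          partitionCount_congr (Q := fun s => s.sup ≤ k + 1 ∧ ¬ s.sup ≤ k)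
            (Q' := fun s => s.sup = k + 1) (fun s _ _ => by omega)]
        rcases Nat.lt_or_ge n (k + 1) with h | h
        · rw [partitionCount_eq_zero, partitionCount_eq_zero]
          · intro s hs hn hk
            have := Multiset.le_sum_of_mem (Multiset.sup_mem (s := s) (by omega))
            omega
          · intro s hs hn hk
            have := Multiset.card_le_sum_of_pos hs
            omega
        · obtain ⟨n, rfl⟩ := Nat.exists_eq_add_of_le' h
          rw [partitionCount_card_eq, partitionCount_sup_eq]
          exact ihn n (by omega)

namespace Multiset

/-- The number of elements larger than `d`, minus `d`. -/
def excess (s : Multiset ℕ) (d : ℕ) : ℤ := s.countAbove d - d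

theorem excess_strictAnti (s : Multiset ℕ) : StrictAnti s.excess :=
  strictAnti_nat_of_succ_lt fun d => by
    have := countAbove_eq_add_count d s
    simp only [excess]
    omega

theorem exists_excess_lt (m : ℤ) (s : Multiset ℕ) : ∃ d, s.excess d < m := by
  refine ⟨(s.card - m + 1).toNat, ?_⟩
  have := countAbove_le_card (s.card - m + 1).toNat s
  simp only [excess]
  omega

/-- The least `d` at which the excess is smaller than `m`. -/
noncomputable def crossing (m : ℤ) (s : Multiset ℕ) : ℕ := sInf {d | s.excess d < m}

theorem excess_crossing_lt (m : ℤ) (s : Multiset ℕ) : s.excess (s.crossing m) < m :=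
  Nat.sInf_mem (s.exists_excess_lt m)

theorem le_excess_of_lt_crossing {m : ℤ} {s : Multiset ℕ} {e : ℕ} (h : e < s.crossing m) :
    m ≤ s.excess e :=
  not_lt.1 (Nat.notMem_of_lt_sInf h)

theorem crossing_eq {m : ℤ} {s : Multiset ℕ} {d : ℕ} (h : s.excess d < m)
    (h' : ∀ e, e + 1 = d → m ≤ s.excess e) : s.crossing m = d := by
  refine le_antisymm (Nat.sInf_le h) (not_lt.1 fun hlt => ?_)
  have h1 := s.excess_strictAnti.antitone (show s.crossing m ≤ d - 1 by omega)
  have h2 := h' (d - 1) (by omega)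
  have h3 := s.excess_crossing_lt m
  omega

theorem not_exists_excess_eq {m : ℤ} {s : Multiset ℕ} {d : ℕ} (h : s.excess d < m)
    (h' : ∀ e, e + 1 = d → m < s.excess e) : ¬ ∃ e, s.excess e = m := by
  rintro ⟨e, he⟩
  rcases lt_or_ge e d with hlt | hle
  · have h1 := s.excess_strictAnti.antitone (show e ≤ d - 1 by omega)
    have h2 := h' (d - 1) (by omega)
    omega
  · have := s.excess_strictAnti.antitone hle
    omega

end Multiset

open Multiset in
/-- Remove column `d` from a partition with excess `m` at `d`, and insert a part `d`. -/
theorem partitionCount_exists_excess_eq {n n' : ℕ} {m : ℤ} (h : (n' : ℤ) = n + m) :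
    partitionCount n' (fun s => ∃ d, s.excess d = m) =
      partitionCount n (fun s => ¬ ∃ d, s.excess d = m + 1) := by
  refine partitionCount_congr_of_inverse
    (fun s => (s.lowerAbove (s.crossing (m + 1))).insertPos (s.crossing (m + 1)))
    (fun s => (s.erase (s.crossing (m + 1))).raiseTop (s.crossing (m + 1))
      (s.crossing (m + 1) + m).toNat) ?_ ?_
  · rintro s hs hn ⟨d, hd⟩
    have hprev : ∀ e, e + 1 = d → m < s.excess e := fun e he => by
      rw [← hd]
      exact s.excess_strictAnti (by omega)
    rw [crossing_eq (d := d) (by omega) fun e he => hprev e he]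
    have hpos := pos_of_mem_lowerAbove (d := d) (s := s)
    have hsum := sum_lowerAbove d s
    have hlt : ((s.lowerAbove d).insertPos d).excess d < m + 1 := by
      have := countAbove_eq_add_count d s
      rw [excess, countAbove_insertPos, countAbove_lowerAbove _ _ le_rfl, if_neg (lt_irrefl d)]
      rw [excess] at hd
      omega
    have hgt : ∀ e, e + 1 = d → m + 1 < ((s.lowerAbove d).insertPos d).excess e := fun e he => by
      have := hprev e he
      rw [excess, countAbove_insertPos, countAbove_lowerAbove_of_lt _ _ (by omega),
        if_pos (by omega)]
      rw [excess] at this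
      push_cast
      omega
    refine ⟨pos_of_mem_insertPos hpos, ?_, not_exists_excess_eq hlt hgt, ?_⟩
    · rw [sum_insertPos]
      rw [excess] at hd
      omega
    · rw [crossing_eq hlt fun e he => (hgt e he).le, erase_insertPos hpos]
      have : (d + m).toNat = s.countAbove d := by rw [← hd, excess]; omega
      rw [this, raiseTop_lowerAbove hs]
  · intro s hs hn hne
    set d := s.crossing (m + 1) with hd
    have hlt : s.excess d < m + 1 := s.excess_crossing_lt (m + 1)
    have hgt : ∀ e, e + 1 = d → m + 1 < s.excess e := fun e he =>
      lt_of_le_of_ne (le_excess_of_lt_crossing (by omega)) fun h => hne ⟨e, h.symm⟩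
    have hpos : ∀ x ∈ s.erase d, 0 < x := fun x hx => hs x (mem_of_mem_erase hx)
    have hmem : d ≠ 0 → d ∈ s := fun h0 => by
      obtain ⟨e, he⟩ := Nat.exists_eq_succ_of_ne_zero h0
      have h1 := hgt e he.symm
      have h2 := countAbove_eq_add_count e s
      rw [Nat.succ_eq_add_one] at he
      rw [← he] at h2
      rw [excess] at h1 hlt
      rw [← count_pos]
      omega
    have hins := insertPos_erase hs hmem
    have hcount (e : ℕ) := countAbove_insertPos e d (s.erase d)
    have hsum := sum_insertPos d (s.erase d)
    simp only [hins] at hcount hsum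
    have hcd := hcount d
    rw [if_neg (lt_irrefl d)] at hcd
    have hl : (s.erase d).countAbove d ≤ (d + m).toNat := by
      rw [excess] at hlt
      omega
    have hl' : d ≠ 0 → (d + m).toNat ≤ (s.erase d).countAbove d + (s.erase d).count d :=
        fun h0 => by
      obtain ⟨e, he⟩ := Nat.exists_eq_succ_of_ne_zero h0
      rw [Nat.succ_eq_add_one] at he
      have h1 := hgt e he.symm
      have h2 := countAbove_eq_add_count e (s.erase d)
      have h3 := hcount e
      rw [if_pos (by omega)] at h3
      rw [← he] at h2
      rw [excess] at h1
      omega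
    have hex : ((s.erase d).raiseTop d (d + m).toNat).excess d = m := by
      rw [excess, countAbove_raiseTop hl]
      rw [excess] at hlt
      omega
    refine ⟨pos_of_mem_raiseTop hpos, ?_, ⟨d, hex⟩, ?_⟩
    · rw [sum_raiseTop hpos hl hl']
      rw [excess] at hlt
      omega
    · have hge : ∀ e, e + 1 = d → m + 1 ≤ ((s.erase d).raiseTop d (d + m).toNat).excess e :=
          fun e he => by
        have := ((s.erase d).raiseTop d (d + m).toNat).excess_strictAnti (show e < d by omega)
        omega
      rw [crossing_eq (by omega) hge, lowerAbove_raiseTop hpos hl hl', hins]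

theorem partitionCount_and_not_add (n : ℕ) (Q : Multiset ℕ → Prop) :
    partitionCount n Q + partitionCount n (fun s => ¬ Q s) = partitionCount n (fun _ => True) := by
  simpa only [true_and] using partitionCount_and_add_and_not n (fun _ => True) Q

theorem partitionCount_and_count_one_ne_zero (n : ℕ) (Q : Multiset ℕ → Prop) :
    partitionCount (n + 1) (fun s => Q s ∧ ¬ s.count 1 = 0) =
      partitionCount n (fun s => Q (1 ::ₘ s)) := by
  refine partitionCount_congr_of_inverse (fun s => s.erase 1) (fun s => 1 ::ₘ s) ?_ ?_
  · rintro s hs hn ⟨hQ, h1⟩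
    have hmem : 1 ∈ s := by simpa [Multiset.count_eq_zero] using h1
    refine ⟨fun x hx => hs x (Multiset.mem_of_mem_erase hx), ?_, ?_, Multiset.cons_erase hmem⟩
    · have := Multiset.sum_erase hmem
      omega
    · rwa [Multiset.cons_erase hmem]
  · intro s hs hn hQ
    refine ⟨?_, ?_, ⟨hQ, by simp⟩, Multiset.erase_cons_head _ _⟩
    · intro x hx
      rcases Multiset.mem_cons.1 hx with rfl | hx
      · omega
      · exact hs x hx
    · rw [Multiset.sum_cons]
      omega

/-- The crank of a partition in terms of its multiset of parts. -/
def Multiset.crank (s : Multiset ℕ) : ℤ :=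
  if s.count 1 = 0 then (s.sup : ℤ) else s.excess (s.count 1)

open Multiset in
/-- Merge as many ones as possible into a part without changing the crossing point. -/
theorem partitionCount_crank_lt_of_lt_card (n : ℕ) (m : ℤ) :
    partitionCount n (fun s => (s.crank < m ∧ ¬ s.count 1 = 0) ∧ ¬ (s.card : ℤ) ≤ m) =
      partitionCount n (fun s => (¬ ∃ d, s.excess d = m) ∧ ¬ (s.card : ℤ) ≤ m) := by
  have hcross : ∀ s : Multiset ℕ, (∀ x ∈ s, 0 < x) → ¬ (s.card : ℤ) ≤ m → 0 < s.crossing m := by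
    intro s hs h
    by_contra h0
    have := s.excess_crossing_lt m
    rw [Nat.eq_zero_of_not_pos h0, excess, countAbove_zero hs] at this
    omega
  have hbelow (e k : ℕ) (s : Multiset ℕ) (he : 0 < e) :
      (s + replicate k 1).countAbove e = s.countAbove e := by
    rw [countAbove_add, countAbove_replicate, if_neg (by omega), add_zero]
  refine partitionCount_congr_of_inverse
    (fun s => s.crossing m ::ₘ (s - replicate (s.crossing m) 1))
    (fun s => s.erase (s.crossing m) + replicate (s.crossing m) 1) ?_ ?_
  · rintro s hs hn ⟨⟨hc, h1⟩, hcard⟩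
    have hd0 := hcross s hs hcard
    rw [crank, if_neg h1] at hc
    have hle : s.crossing m ≤ s.count 1 := Nat.sInf_le hc
    have hlt := s.excess_crossing_lt m
    have hge : ∀ e, e < s.crossing m → m ≤ s.excess e := fun e he => le_excess_of_lt_crossing he
    set d := s.crossing m
    have hsub : s - replicate d 1 + replicate d 1 = s :=
      tsub_add_cancel_of_le (le_count_iff_replicate_le.1 hle)
    have hpos : ∀ x ∈ d ::ₘ (s - replicate d 1), 0 < x := by
      intro x hx
      rcases mem_cons.1 hx with rfl | hx
      · exact hd0
      · exact hs x (mem_of_le (Multiset.sub_le_self _ _) hx)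
    have hcount (e : ℕ) (he : 0 < e) : (d ::ₘ (s - replicate d 1)).countAbove e =
        s.countAbove e + if e < d then 1 else 0 := by
      rw [countAbove_cons, ← hbelow e d _ he, hsub]
    have hlt' : (d ::ₘ (s - replicate d 1)).excess d < m := by
      rw [excess, hcount d hd0, if_neg (lt_irrefl d)]
      exact hlt
    have hgt' : ∀ e, e + 1 = d → m < (d ::ₘ (s - replicate d 1)).excess e := by
      intro e he
      rcases Nat.eq_zero_or_pos e with rfl | he0
      · have : d ::ₘ (s - replicate d 1) = s := by
          rw [← singleton_add, add_comm, ← replicate_one, ← he]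
          rw [← he] at hsub
          exact hsub
        rw [this, excess, countAbove_zero hs]
        omega
      · have := hge e (by omega)
        rw [excess] at this ⊢
        rw [hcount e he0, if_pos (by omega)]
        push_cast
        omega
    have hcr := crossing_eq hlt' fun e he => (hgt' e he).le
    refine ⟨hpos, ?_, ⟨not_exists_excess_eq hlt' hgt', ?_⟩, ?_⟩
    · have := congrArg Multiset.sum hsub
      rw [sum_add, sum_replicate, smul_eq_mul, mul_one] at this
      rw [Multiset.sum_cons]
      omega
    · have h0 : m < (d ::ₘ (s - replicate d 1)).excess 0 :=
        (hgt' (d - 1) (by omega)).trans_le ((excess_strictAnti _).antitone (Nat.zero_le _))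
      rw [excess, countAbove_zero hpos] at h0
      omega
    · rw [hcr, erase_cons_head, hsub]
  · rintro s hs hn ⟨hne, hcard⟩
    have hd0 := hcross s hs hcard
    have hlt := s.excess_crossing_lt m
    have hgt : ∀ e, e < s.crossing m → m < s.excess e := fun e he =>
      lt_of_le_of_ne (le_excess_of_lt_crossing he) fun h => hne ⟨e, h.symm⟩
    set d := s.crossing m
    have hmem : d ∈ s := by
      have h1 := hgt (d - 1) (by omega)
      have h2 := countAbove_eq_add_count (d - 1) s
      rw [Nat.sub_add_cancel hd0] at h2
      rw [excess] at h1 hlt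
      rw [← count_pos]
      omega
    have hcons := cons_erase hmem
    have hpos : ∀ x ∈ s.erase d + replicate d 1, 0 < x := by
      intro x hx
      rcases mem_add.1 hx with hx | hx
      · exact hs x (mem_of_mem_erase hx)
      · rw [eq_of_mem_replicate hx]; exact one_pos
    have hcount (e : ℕ) (he : 0 < e) : (s.erase d + replicate d 1).countAbove e +
        (if e < d then 1 else 0) = s.countAbove e := by
      rw [hbelow e d _ he, ← countAbove_cons, hcons]
    have hlt' : (s.erase d + replicate d 1).excess d < m := by
      have := hcount d hd0
      rw [if_neg (lt_irrefl d), add_zero] at this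
      rw [excess, this]
      exact hlt
    have hcard' : (s.erase d + replicate d 1).card + 1 = s.card + d := by
      rw [card_add, card_replicate, ← congrArg Multiset.card hcons, Multiset.card_cons]
      omega
    have hcard'' : ¬ ((s.erase d + replicate d 1).card : ℤ) ≤ m := by omega
    have hge' : ∀ e, e + 1 = d → m ≤ (s.erase d + replicate d 1).excess e := by
      intro e he
      rcases Nat.eq_zero_or_pos e with rfl | he0
      · rw [excess, countAbove_zero hpos]
        omega
      · have h1 := hcount e he0
        have h2 := hgt e (by omega)
        rw [if_pos (by omega)] at h1
        rw [excess] at h2 ⊢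
        omega
    have hle : d ≤ (s.erase d + replicate d 1).count 1 := by simp
    refine ⟨hpos, ?_, ⟨⟨?_, by omega⟩, hcard''⟩, ?_⟩
    · rw [sum_add, sum_replicate, smul_eq_mul, mul_one, ← hn, ← congrArg Multiset.sum hcons, Multiset.sum_cons]
      omega
    · rw [crank, if_neg (by omega)]
      exact ((excess_strictAnti _).antitone hle).trans_lt hlt'
    · rw [crossing_eq hlt' hge', Multiset.add_sub_cancel_right, hcons]

theorem partitionCount_crank_lt_add (n : ℕ) (k : ℕ) :
    partitionCount (n + 2) (fun s => s.sup ≤ k ∧ s.count 1 = 0) +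
      partitionCount (n + 2) (fun s => s.card ≤ k + 1 ∧ ¬ s.count 1 = 0) =
        partitionCount (n + 2) (fun s => s.card ≤ k) := by
  rw [partitionCount_card_le_eq_sup_le,
    ← partitionCount_and_add_and_not (n + 2) (fun s => s.sup ≤ k) (fun s => s.count 1 = 0)]
  congr 1
  rw [partitionCount_and_count_one_ne_zero (n + 1), partitionCount_and_count_one_ne_zero (n + 1)]
  simp only [Multiset.card_cons, Nat.add_le_add_iff_right, Multiset.sup_cons, sup_le_iff]
  rcases k with _ | k
  · rw [partitionCount_eq_zero, partitionCount_eq_zero]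
    · omega
    · intro s hs hn h
      rw [Nat.le_zero, Multiset.card_eq_zero] at h
      simp [h] at hn
  · rw [partitionCount_card_le_eq_sup_le]
    exact partitionCount_congr fun s _ _ => by omega

theorem partitionCount_crank_lt (n : ℕ) (m : ℤ) :
    partitionCount (n + 2) (fun s => s.crank < m) =
      partitionCount (n + 2) (fun s => ¬ ∃ d, s.excess d = m) := by
  rw [← partitionCount_and_add_and_not _ _ (fun s => s.count 1 = 0),
    ← partitionCount_and_add_and_not _ (fun s => s.crank < m ∧ ¬ s.count 1 = 0)
      (fun s => (s.card : ℤ) ≤ m), partitionCount_crank_lt_of_lt_card,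
    ← partitionCount_and_add_and_not _ (fun s => ¬ ∃ d, s.excess d = m)
      (fun s => (s.card : ℤ) ≤ m), ← add_assoc]
  congr 1
  have h1 : partitionCount (n + 2) (fun s => s.crank < m ∧ s.count 1 = 0) =
      partitionCount (n + 2) (fun s => (s.sup : ℤ) < m ∧ s.count 1 = 0) :=
    partitionCount_congr fun s _ _ => and_congr_left fun h => by rw [Multiset.crank, if_pos h]
  have h2 : partitionCount (n + 2)
      (fun s => (s.crank < m ∧ ¬ s.count 1 = 0) ∧ (s.card : ℤ) ≤ m) =
      partitionCount (n + 2) (fun s => (s.card : ℤ) ≤ m ∧ ¬ s.count 1 = 0) :=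
    partitionCount_congr fun s hs _ => by
      refine ⟨fun h => ⟨h.2, h.1.2⟩, fun h => ⟨⟨?_, h.2⟩, h.1⟩⟩
      rw [Multiset.crank, if_neg h.2]
      have := s.excess_strictAnti (Nat.pos_of_ne_zero h.2)
      rw [Multiset.excess, Multiset.excess, Multiset.countAbove_zero hs] at this
      have := h.1
      rw [Multiset.excess]
      omega
  have h3 : partitionCount (n + 2) (fun s => (¬ ∃ d, s.excess d = m) ∧ (s.card : ℤ) ≤ m) =
      partitionCount (n + 2) (fun s => (s.card : ℤ) < m) :=
    partitionCount_congr fun s hs _ => by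
      have h0 : s.excess 0 = s.card := by simp [Multiset.excess, Multiset.countAbove_zero hs]
      refine ⟨fun h => lt_of_le_of_ne h.2 fun h' => h.1 ⟨0, h0.trans h'⟩, fun h => ⟨?_, h.le⟩⟩
      exact Multiset.not_exists_excess_eq (d := 0) (by omega) (by omega)
  rw [h1, h2, h3]
  rcases le_or_gt m 0 with hm | hm
  · rw [partitionCount_eq_zero, partitionCount_eq_zero, partitionCount_eq_zero]
    · intro s _ _ h
      omega
    · intro s hs _ h
      have := s.count_le_card 1
      omega
    · intro s _ _ h
      omega
  · obtain ⟨k, rfl⟩ : ∃ k : ℕ, m = k + 1 := ⟨(m - 1).toNat, by omega⟩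
    rw [partitionCount_congr (Q := fun s => (s.sup : ℤ) < k + 1 ∧ s.count 1 = 0)
        (Q' := fun s => s.sup ≤ k ∧ s.count 1 = 0) (fun s _ _ => by omega),
      partitionCount_congr (Q := fun s => (s.card : ℤ) ≤ k + 1 ∧ ¬ s.count 1 = 0)
        (Q' := fun s => s.card ≤ k + 1 ∧ ¬ s.count 1 = 0) (fun s _ _ => by omega),
      partitionCount_congr (Q := fun s => (s.card : ℤ) < k + 1)
        (Q' := fun s => s.card ≤ k) (fun s _ _ => by omega)]
    exact partitionCount_crank_lt_add n k

theorem rankCount_eq_partitionCount (m : ℤ) (n : ℕ) :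
    rankCount m n = partitionCount n (fun s => (s.sup : ℤ) - s.card = m) := by
  simp only [rankCount, partitionCount, Nat.Partition.rank]
  congr!

theorem crankCount_eq_partitionCount {m : ℤ} {n : ℕ} (hn : n ≠ 1) :
    crankCount m n = partitionCount n (fun s => s.crank = m) := by
  have h (p : n.Partition) : p.crank = p.parts.crank := by
    simp only [Nat.Partition.crank, Multiset.crank, Multiset.excess, Multiset.countAbove]
  simp only [crankCount, if_neg hn, partitionCount, h]

theorem partitionCount_eq_add_of_lt (n : ℕ) (f : Multiset ℕ → ℤ) {a b : ℤ} (h : a ≤ b) :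
    partitionCount n (fun s => f s < b) =
      partitionCount n (fun s => f s < a) + partitionCount n (fun s => a ≤ f s ∧ f s < b) := by
  rw [← partitionCount_and_add_and_not n (fun s => f s < b) (fun s => f s < a)]
  congr 1 <;> exact partitionCount_congr fun s _ _ => by omega

theorem partitionCount_of_unique {n : ℕ} {Q : Multiset ℕ → Prop} (s : Multiset ℕ)
    (h : ∀ p : n.Partition, p.parts = s) [Unique n.Partition] [Decidable (Q s)] :
    partitionCount n Q = if Q s then 1 else 0 := by
  simp only [partitionCount, h]
  split_ifs with hQ <;> simp [hQ]

open Multiset in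
theorem crankCount_eq_sub (m : ℤ) (n : ℕ) :
    crankCount m n = (partitionCount n (fun s => ∃ d, s.excess d = m) : ℤ) -
      partitionCount n (fun s => ∃ d, s.excess d = m + 1) := by
  classical
  match n with
  | 0 =>
    have h (m : ℤ) : (∃ d, excess 0 d = m) ↔ m ≤ 0 := by
      simp only [excess, countAbove_nil]
      exact ⟨fun ⟨d, hd⟩ => by omega, fun h => ⟨(-m).toNat, by omega⟩⟩
    rw [crankCount_eq_partitionCount zero_ne_one,
      partitionCount_of_unique 0 Nat.Partition.partition_zero_parts,
      partitionCount_of_unique 0 Nat.Partition.partition_zero_parts,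
      partitionCount_of_unique 0 Nat.Partition.partition_zero_parts]
    simp only [h, crank, count_zero, if_true, Multiset.sup_zero, Nat.bot_eq_zero, Nat.cast_zero]
    split_ifs <;> first | rfl | omega
  | 1 =>
    have h (m : ℤ) : (∃ d, excess {1} d = m) ↔ m = 1 ∨ m < 0 := by
      have hc (d : ℕ) : countAbove d {1} = if d < 1 then 1 else 0 := by
        rw [← replicate_one, countAbove_replicate]
      simp only [excess, hc]
      refine ⟨fun ⟨d, hd⟩ => by split_ifs at hd <;> omega, fun h => ⟨(-m).toNat, ?_⟩⟩
      split_ifs <;> omega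
    rw [partitionCount_of_unique {1} Nat.Partition.partition_one_parts,
      partitionCount_of_unique {1} Nat.Partition.partition_one_parts]
    simp only [crankCount, h, if_true]
    split_ifs <;> omega
  | n + 2 =>
    rw [crankCount_eq_partitionCount (by omega)]
    have h1 := partitionCount_eq_add_of_lt (n + 2) crank (show m ≤ m + 1 by omega)
    rw [partitionCount_crank_lt, partitionCount_crank_lt,
      partitionCount_congr (Q := fun s => m ≤ s.crank ∧ s.crank < m + 1)
        (Q' := fun s => s.crank = m) (fun s _ _ => by omega)] at h1
    have h2 := partitionCount_and_not_add (n + 2) (fun s => ∃ d, s.excess d = m)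
    have h3 := partitionCount_and_not_add (n + 2) (fun s => ∃ d, s.excess d = m + 1)
    omega

open Multiset in
/-- Split a partition into its parts divisible by `3` and the remaining ones. -/
theorem sum_partitionCount_mul_p3 (n : ℕ) :
    ∑ k ∈ range (n / 3 + 1), partitionCount k (fun _ => True) * p3 (n - 3 * k) =
      partitionCount n (fun _ => True) := by
  classical
  have hsum (s : Multiset ℕ) :
      3 * ((s.filter (3 ∣ ·)).map (· / 3)).sum + (s.filter (¬ 3 ∣ ·)).sum = s.sum := by
    induction s using Multiset.induction_on with
    | empty => simp
    | cons a s ih =>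
      by_cases h : 3 ∣ a
      · simp only [h, Multiset.filter_cons_of_pos, Multiset.map_cons, Multiset.sum_cons, not_true_eq_false,
          not_false_eq_true, Multiset.filter_cons_of_neg]
        omega
      · simp only [h, Multiset.filter_cons_of_pos, Multiset.sum_cons,
          not_false_eq_true, Multiset.filter_cons_of_neg]
        omega
  have hjoin (s t : Multiset ℕ) (ht : ∀ x ∈ t, x % 3 = 1 ∨ x % 3 = 2) :
      ((s.map (3 * ·) + t).filter (3 ∣ ·)).map (· / 3) = s ∧
        (s.map (3 * ·) + t).filter (¬ 3 ∣ ·) = t := by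
    have h1 : ∀ x ∈ s.map (3 * ·), 3 ∣ x := fun x hx => by
      obtain ⟨y, -, rfl⟩ := mem_map.1 hx
      exact dvd_mul_right 3 y
    have h2 : ∀ x ∈ t, ¬ 3 ∣ x := fun x hx => by
      have := ht x hx
      omega
    rw [filter_add, filter_add, filter_eq_self.2 h1, filter_eq_nil.2 h2, filter_eq_self.2 h2,
      filter_eq_nil.2 fun x hx => not_not.2 (h1 x hx), add_zero, zero_add, Multiset.map_map]
    exact ⟨(map_congr rfl fun x _ => Nat.mul_div_cancel_left x three_pos).trans (map_id' _), rfl⟩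
  symm
  simp only [partitionCount, Finset.filter_true]
  rw [Finset.card_eq_sum_card_fiberwise (t := range (n / 3 + 1))
    (f := fun p : n.Partition => ((p.parts.filter (3 ∣ ·)).map (· / 3)).sum)]
  · refine Finset.sum_congr rfl fun k hk => ?_
    rw [Finset.mem_range] at hk
    rw [p3, ← Finset.card_product]
    refine Finset.card_bij'
      (fun p hp => (⟨(p.parts.filter (3 ∣ ·)).map (· / 3), fun {x} hx => ?_, ?_⟩,
        ⟨p.parts.filter (¬ 3 ∣ ·), fun hx => p.parts_pos (mem_of_mem_filter hx), ?_⟩))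
      (fun q hq => ⟨q.1.parts.map (3 * ·) + q.2.parts, fun {x} hx => ?_, ?_⟩) ?_ ?_ ?_ ?_
    · obtain ⟨y, hy, rfl⟩ := mem_map.1 hx
      obtain ⟨hy, h3⟩ := mem_filter.1 hy
      have := p.parts_pos hy
      omega
    · simpa using hp
    · have := hsum p.parts
      rw [p.parts_sum] at this
      simp at hp
      omega
    · rcases mem_add.1 hx with hx | hx
      · obtain ⟨y, hy, rfl⟩ := mem_map.1 hx
        have := q.1.parts_pos hy
        omega
      · exact q.2.parts_pos hx
    · rw [sum_add, sum_map_mul_left, map_id', q.1.parts_sum, q.2.parts_sum]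
      omega
    · intro p hp
      simp
      intros
      omega
    · intro q hq
      simp only [Finset.mem_product, Finset.mem_filter, Finset.mem_univ, true_and] at hq
      simp only [Finset.mem_filter, Finset.mem_univ, true_and]
      rw [(hjoin _ _ hq).1, q.1.parts_sum]
    · intro p hp
      apply Nat.Partition.ext
      have h3 : ((p.parts.filter (3 ∣ ·)).map (· / 3)).map (3 * ·) = p.parts.filter (3 ∣ ·) := by
        rw [Multiset.map_map]
        refine (map_congr rfl fun x hx => ?_).trans (map_id' _)
        exact Nat.mul_div_cancel' (Multiset.mem_filter.1 hx).2
      dsimp only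
      rw [h3, filter_add_not]
    · intro q hq
      simp only [Finset.mem_product, Finset.mem_filter, Finset.mem_univ, true_and] at hq
      exact Prod.ext (Nat.Partition.ext (hjoin _ _ hq).1) (Nat.Partition.ext (hjoin _ _ hq).2)
  · intro p _
    have := hsum p.parts
    rw [p.parts_sum] at this
    simp
    omega

open Multiset in
theorem sum_partitionCount_excess_mul_p3 {n n' : ℕ} {m : ℤ} (h : (n' : ℤ) = n + 3 * m) :
    ∑ k ∈ range (n' / 3 + 1), partitionCount k (fun s => ∃ d, s.excess d = m) * p3 (n' - 3 * k) +
      ∑ k ∈ range (n / 3 + 1),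
        partitionCount k (fun s => ∃ d, s.excess d = m + 1) * p3 (n - 3 * k) =
      partitionCount n (fun _ => True) := by
  have hcompl (k : ℕ) := partitionCount_and_not_add k (fun s => ∃ d, s.excess d = m + 1)
  rw [← sum_partitionCount_mul_p3 n]
  rcases le_total 0 m with hm | hm
  · obtain ⟨j, rfl⟩ := Int.eq_ofNat_of_zero_le hm
    rw [show n' / 3 + 1 = j + (n / 3 + 1) by omega, Finset.sum_range_add,
      Finset.sum_eq_zero, zero_add, ← Finset.sum_add_distrib]
    · refine Finset.sum_congr rfl fun k _ => ?_
      rw [← hcompl k, show n' - 3 * (j + k) = n - 3 * k by omega,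
        partitionCount_exists_excess_eq (n := k) (by push_cast; ring)]
      ring
    · intro k hk
      rw [Finset.mem_range] at hk
      rw [partitionCount_eq_zero, zero_mul]
      rintro s hs hn ⟨d, hd⟩
      have h1 := s.excess_strictAnti.antitone (Nat.zero_le d)
      rw [hd, excess, countAbove_zero hs] at h1
      have h2 := card_le_sum_of_pos hs
      omega
  · obtain ⟨j, rfl⟩ := Int.exists_eq_neg_ofNat hm
    rw [show n / 3 + 1 = j + (n' / 3 + 1) by omega, Finset.sum_range_add (n := j),
      Finset.sum_range_add (n := j), add_left_comm, ← Finset.sum_add_distrib]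
    congr 1
    · refine Finset.sum_congr rfl fun k hk => ?_
      rw [Finset.mem_range] at hk
      rw [← hcompl k, partitionCount_eq_zero (Q := fun s => ¬ _), add_zero]
      intro s hs hn hne
      refine hne ⟨j - 1, ?_⟩
      have : s.countAbove (j - 1) = 0 := by
        rw [countAbove, Multiset.card_eq_zero, filter_eq_nil]
        intro a ha
        have := le_sum_of_mem ha
        omega
      rw [excess, this]
      omega
    · refine Finset.sum_congr rfl fun k _ => ?_
      rw [← hcompl (j + k), show n - 3 * (j + k) = n' - 3 * k by omega,
        partitionCount_exists_excess_eq (n := j + k) (by push_cast; ring)]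
      ring

theorem partitionCount_le_rank_add {n n' : ℕ} {m : ℤ} (h : (n' : ℤ) = n + 3 * m) :
    partitionCount n' (fun s => 3 * m - 1 ≤ (s.sup : ℤ) - s.card) +
      partitionCount n (fun s => 3 * (m + 1) - 1 ≤ (s.sup : ℤ) - s.card) =
      partitionCount n (fun _ => True) := by
  have h1 := partitionCount_rank_le (n := n) (n' := n') (r := 3 * m + 1) (by omega)
  have h2 := partitionCount_and_not_add n (fun s => (s.sup : ℤ) - s.card ≤ 3 * m + 1)
  rw [partitionCount_congr (Q := fun s => 3 * m + 1 - 2 ≤ (s.sup : ℤ) - s.card)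
    (Q' := fun s => 3 * m - 1 ≤ (s.sup : ℤ) - s.card)
    (fun s _ _ => by omega)] at h1
  rw [partitionCount_congr (Q := fun s => ¬ (s.sup : ℤ) - s.card ≤ 3 * m + 1)
    (Q' := fun s => 3 * (m + 1) - 1 ≤ (s.sup : ℤ) - s.card) (fun s _ _ => by omega)] at h2
  omega

theorem eq_of_add_succ_eq {f g : ℤ → ℕ → ℕ} {p : ℕ → ℕ}
    (hf : ∀ {m : ℤ} {n n' : ℕ}, (n' : ℤ) = n + 3 * m → f m n' + f (m + 1) n = p n)
    (hg : ∀ {m : ℤ} {n n' : ℕ}, (n' : ℤ) = n + 3 * m → g m n' + g (m + 1) n = p n)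
    (hf' : ∀ (m : ℤ) (n : ℕ), 0 < m → (n : ℤ) < 3 * m → f m n = 0)
    (hg' : ∀ (m : ℤ) (n : ℕ), 0 < m → (n : ℤ) < 3 * m → g m n = 0) (m : ℤ) (n : ℕ) :
    f m n = g m n := by
  have hpos : ∀ n : ℕ, ∀ m : ℤ, 0 < m → f m n = g m n := by
    intro n
    induction n using Nat.strong_induction_on with
    | _ n ih =>
      intro m hm
      rcases lt_or_ge (n : ℤ) (3 * m) with h | h
      · rw [hf' m n hm h, hg' m n hm h]
      · have h0 : (n : ℤ) = (n - 3 * m).toNat + 3 * m := by omega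
        have h1 := ih (n - 3 * m).toNat (by omega) (m + 1) (by omega)
        have h2 := hf h0
        have h3 := hg h0
        omega
  have hneg : ∀ k : ℕ, ∀ (m : ℤ) (n : ℕ), 1 - k ≤ m → f m n = g m n := by
    intro k
    induction k with
    | zero => exact fun m n h => hpos n m (by omega)
    | succ k ih =>
      intro m n h
      rcases lt_or_ge 0 m with hm | hm
      · exact hpos n m hm
      · have h0 : (n : ℤ) = (n - 3 * m).toNat + 3 * m := by omega
        have h1 := ih (m + 1) (n - 3 * m).toNat (by omega)
        have h2 := hf h0
        have h3 := hg h0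
        omega
  exact hneg (1 - m).toNat m n (by omega)

open Multiset in
theorem partitionCount_le_rank_eq_sum (m : ℤ) (n : ℕ) :
    partitionCount n (fun s => 3 * m - 1 ≤ (s.sup : ℤ) - s.card) =
      ∑ k ∈ range (n / 3 + 1),
        partitionCount k (fun s => ∃ d, s.excess d = m) * p3 (n - 3 * k) := by
  refine eq_of_add_succ_eq
    (f := fun m n => partitionCount n (fun s => 3 * m - 1 ≤ (s.sup : ℤ) - s.card))
    (g := fun m n => ∑ k ∈ range (n / 3 + 1),
      partitionCount k (fun s => ∃ d, s.excess d = m) * p3 (n - 3 * k))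
    partitionCount_le_rank_add sum_partitionCount_excess_mul_p3 ?_ ?_ m n
  · intro m n hm hn
    refine partitionCount_eq_zero fun s hs hsum h => ?_
    have hmem := Multiset.sup_mem (s := s) (by omega)
    have h1 := sum_erase hmem
    have h2 := card_erase_add_one hmem
    have h3 := card_le_sum_of_pos fun x hx => hs x (mem_of_mem_erase (a := x) (b := s.sup) hx)
    omega
  · intro m n hm hn
    refine Finset.sum_eq_zero fun k hk => ?_
    rw [Finset.mem_range] at hk
    rw [partitionCount_eq_zero, zero_mul]
    rintro s hs hsum ⟨d, hd⟩
    have h1 := s.excess_strictAnti.antitone (Nat.zero_le d)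
    rw [hd, excess, countAbove_zero hs] at h1
    have h2 := card_le_sum_of_pos hs
    omega

/-- the rank-crank relation for partition counts. -/
theorem rank_crank_count (m : ℤ) (n : ℕ) :
    (rankCount (3 * m - 1) n : ℤ) + rankCount (3 * m) n + rankCount (3 * m + 1) n =
      ∑ k ∈ Finset.range (n / 3 + 1), crankCount m k * (p3 (n - 3 * k) : ℤ) := by
  have hstep (r : ℤ) : partitionCount n (fun s => r ≤ (s.sup : ℤ) - s.card) =
      rankCount r n + partitionCount n (fun s => r + 1 ≤ (s.sup : ℤ) - s.card) := by
    rw [rankCount_eq_partitionCount, ← partitionCount_and_add_and_not n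
      (fun s => r ≤ (s.sup : ℤ) - s.card) (fun s => (s.sup : ℤ) - s.card = r)]
    congr 1 <;> exact partitionCount_congr fun s _ _ => by omega
  have h0 := hstep (3 * m - 1)
  have h1 := hstep (3 * m)
  have h2 := hstep (3 * m + 1)
  rw [sub_add_cancel] at h0
  rw [show 3 * m + 1 + 1 = 3 * (m + 1) - 1 by ring] at h2
  simp only [crankCount_eq_sub, sub_mul, Finset.sum_sub_distrib]
  have h3 := partitionCount_le_rank_eq_sum m n
  have h4 := partitionCount_le_rank_eq_sum (m + 1) n
  zify at h3 h4
  rw [← h3, ← h4]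
  omega

end
end
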